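/- arXiv:1312.2138 — 2 statements merged into one kernel-verified Lean document; each statement's English description precedes it below -/
import Mathlib

section
/- Let f : [0,∞) → [0,∞) and α : [0,1] → (0,∞) be continuous functions with f(0) = 0, and set F(ξ) = ∫₀^ξ f(t) dt. Assume that for some a > 0 the function ξ ↦ F(ξ)/ξ² is non-increasing on (0,a]. Then the following two assertions are equivalent: (i) for each b > 0, the function ξ ↦ F(ξ)/ξ² is not constant on (0,b]; (ii) for each r > 0, there exists a nonempty open interval I ⊆ (0,∞) such that for every λ ∈ I there exists a function u : [0,1] → ℝ, twice continuously differentiable, satisfying −u''(t) = λ α(t) f(u(t)) for all t ∈ [0,1], u(t) > 0 for all t ∈ (0,1), u(0) = u(1) = 0, and ∫₀¹ |u'(t)|² dt < r. -/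
open Set MeasureTheory

section DirichletProblem

open Filter Topology
open scoped RealInnerProductSpace

section Hilbert

variable {H : Type*} [NormedAddCommGroup H] [InnerProductSpace ℝ H] [CompleteSpace H]
  [TopologicalSpace.SeparableSpace H]

/-- Weak sequential compactness of closed balls in a separable Hilbert space. -/
theorem exists_weakly_convergent_subseq {R : ℝ} {v : ℕ → H} (hv : ∀ n, ‖v n‖ ≤ R) :
    ∃ w : H, ‖w‖ ≤ R ∧ ∃ φ : ℕ → ℕ, StrictMono φ ∧
      ∀ h, Tendsto (fun n => ⟪v (φ n), h⟫) atTop (𝓝 ⟪w, h⟫) := by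
  let e := InnerProductSpace.toDual ℝ H
  have hmem : ∀ n, StrongDual.toWeakDual (e (v n)) ∈
      (WeakDual.toStrongDual ⁻¹' Metric.closedBall (0 : StrongDual ℝ H) R) := by
    intro n
    simp [e, hv n]
  obtain ⟨ℓ, hℓ, φ, hφ, hlim⟩ := WeakDual.isSeqCompact_closedBall ℝ H 0 R hmem
  refine ⟨e.symm (WeakDual.toStrongDual ℓ), ?_, φ, hφ, fun h => ?_⟩
  · simpa using hℓ
  · have h1 := ((WeakDual.eval_continuous h).tendsto ℓ).comp hlim
    have h2 : ⟪e.symm (WeakDual.toStrongDual ℓ), h⟫ = ℓ h := by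
      simp [e, InnerProductSpace.toDual_symm_apply]
    rw [h2]
    refine h1.congr fun n => ?_
    simp [e]

/-- The direct method: a weakly sequentially continuous bounded perturbation of a nonnegative
multiple of the squared norm attains its minimum on a closed ball. -/
theorem exists_isMinOn_sq_norm_sub {R : ℝ} (hR : 0 ≤ R) {J : H → ℝ} {c C : ℝ} (hc : 0 ≤ c)
    (hC : ∀ v, ‖v‖ ≤ R → J v ≤ C)
    (hJ : ∀ (v : ℕ → H) (w : H), (∀ n, ‖v n‖ ≤ R) →
      (∀ h, Tendsto (fun n => ⟪v n, h⟫) atTop (𝓝 ⟪w, h⟫)) →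
      Tendsto (fun n => J (v n)) atTop (𝓝 (J w))) :
    ∃ v, ‖v‖ ≤ R ∧ ∀ w, ‖w‖ ≤ R → c * ‖v‖ ^ 2 - J v ≤ c * ‖w‖ ^ 2 - J w := by
  let Φ : H → ℝ := fun v => c * ‖v‖ ^ 2 - J v
  let S : Set ℝ := Φ '' {v | ‖v‖ ≤ R}
  have hS : S.Nonempty := ⟨Φ 0, 0, by simpa using hR, rfl⟩
  have hbdd : BddBelow S := by
    refine ⟨-C, ?_⟩
    rintro _ ⟨v, hv, rfl⟩
    have := hC v hv
    have : 0 ≤ c * ‖v‖ ^ 2 := by positivity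
    simp only [Φ]
    linarith
  obtain ⟨y, -, hy, hyS⟩ := exists_seq_tendsto_sInf hS hbdd
  choose v hv hvy using hyS
  obtain ⟨w, hw, φ, hφ, hlim⟩ := exists_weakly_convergent_subseq hv
  refine ⟨w, hw, fun z hz => ?_⟩
  have hle : Φ w ≤ sInf S := by
    have h1 := hJ (fun n => v (φ n)) w (fun n => hv _) hlim
    have h2 : Tendsto (fun n => c * (2 * ⟪v (φ n), w⟫ - ‖w‖ ^ 2) - J (v (φ n))) atTop
        (𝓝 (c * (2 * ⟪w, w⟫ - ‖w‖ ^ 2) - J w)) :=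
      ((((hlim w).const_mul 2).sub_const _).const_mul c).sub h1
    have h3 : c * (2 * ⟪w, w⟫ - ‖w‖ ^ 2) - J w = Φ w := by
      simp only [Φ, real_inner_self_eq_norm_sq]
      ring
    rw [h3] at h2
    refine le_of_tendsto_of_tendsto' h2 (hy.comp hφ.tendsto_atTop) fun n => ?_
    simp only [Function.comp_apply, ← hvy, Φ]
    have h4 : 0 ≤ c * ‖v (φ n) - w‖ ^ 2 := by positivity
    rw [norm_sub_sq_real] at h4
    linarith
  exact hle.trans (csInf_le hbdd ⟨z, hz, rfl⟩)

end Hilbert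

/-- The Green function of the negative second derivative on the unit interval with Dirichlet
conditions is the Gram kernel of a
continuous curve in a separable Hilbert space. -/
theorem exists_continuous_inner_eq_green :
    ∃ k : ℝ → Lp ℝ 2 (volume : Measure ℝ), Continuous k ∧ (∀ t, ‖k t‖ ≤ 1) ∧
      ∀ s ∈ Icc (0 : ℝ) 1, ∀ t ∈ Icc (0 : ℝ) 1, ⟪k s, k t⟫ = min s t - s * t := by
  let E : ℝ → Lp ℝ 2 (volume : Measure ℝ) := fun t =>
    indicatorConstLp 2 (measurableSet_Ioc (a := 0) (b := t)) measure_Ioc_lt_top.ne (1 : ℝ)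
  have hE : ∀ s t, 0 ≤ s → 0 ≤ t → ⟪E s, E t⟫ = min s t := by
    intro s t hs ht
    simp only [E]
    rw [L2.real_inner_indicatorConstLp_one_indicatorConstLp_one _ _ measure_Ioc_lt_top.ne
      measure_Ioc_lt_top.ne, Ioc_inter_Ioc]
    simp [hs, ht]
  let c : ℝ → ℝ := fun t => max 0 (min t 1)
  have hc : Continuous c := by fun_prop
  have hc0 : ∀ t, 0 ≤ c t := fun t => le_max_left _ _
  have hc1 : ∀ t, c t ≤ 1 := fun t => max_le zero_le_one (min_le_right _ _)
  have hcid : ∀ t ∈ Icc (0 : ℝ) 1, c t = t := by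
    intro t ht
    simp [c, ht.1, ht.2]
  let k : ℝ → Lp ℝ 2 (volume : Measure ℝ) := fun t => E (c t) - c t • E 1
  have hk : ∀ s t, ⟪k s, k t⟫ = min (c s) (c t) - c s * c t := by
    intro s t
    simp only [k, inner_sub_left, inner_sub_right, real_inner_smul_left, real_inner_smul_right]
    rw [hE _ _ (hc0 s) (hc0 t), hE _ _ (hc0 s) zero_le_one, hE _ _ zero_le_one (hc0 t),
      hE _ _ zero_le_one zero_le_one, min_eq_left (hc1 s), min_eq_right (hc1 t), min_self]
    ring
  refine ⟨k, ?_, fun t => ?_, fun s hs t ht => by rw [hk, hcid s hs, hcid t ht]⟩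
  · rw [continuous_iff_continuousAt]
    intro t
    rw [ContinuousAt, tendsto_iff_norm_sub_tendsto_zero]
    have h1 : ∀ s, ‖k s - k t‖ = √((c s - c s * c s) - 2 * (min (c s) (c t) - c s * c t)
        + (c t - c t * c t)) := by
      intro s
      rw [← Real.sqrt_sq (norm_nonneg (k s - k t)), norm_sub_sq_real, hk,
        ← real_inner_self_eq_norm_sq, ← real_inner_self_eq_norm_sq, hk, hk, min_self, min_self]
    simp_rw [h1]
    have h2 : Continuous fun s => √((c s - c s * c s) - 2 * (min (c s) (c t) - c s * c t)
        + (c t - c t * c t)) := by fun_prop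
    have h3 := h2.tendsto t
    rw [min_self] at h3
    convert h3 using 2
    rw [eq_comm, Real.sqrt_eq_zero']
    linarith
  · have h1 : ‖k t‖ ^ 2 ≤ 1 := by
      rw [← real_inner_self_eq_norm_sq, hk, min_self]
      nlinarith [hc0 t, hc1 t]
    nlinarith [norm_nonneg (k t)]

/-- Classical solutions of the linear problem are given by the Green function. -/
theorem exists_hasDerivAt_of_green {g : ℝ → ℝ} (hg : Continuous g) :
    ∃ U D : ℝ → ℝ, (∀ t, HasDerivAt U (D t) t) ∧ (∀ t, HasDerivAt D (-g t) t) ∧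
      ∀ s ∈ Icc (0 : ℝ) 1, U s = ∫ t in (0 : ℝ)..1, g t * (min s t - s * t) := by
  have hprim : ∀ (h : ℝ → ℝ), Continuous h → ∀ t, HasDerivAt (fun x => ∫ y in (0 : ℝ)..x, h y)
      (h t) t := fun h hh t => intervalIntegral.integral_hasDerivAt_right
        (hh.intervalIntegrable _ _) (hh.stronglyMeasurableAtFilter _ _) hh.continuousAt
  let A := ∫ t in (0 : ℝ)..1, g t * (1 - t)
  refine ⟨fun s => s * A - s * (∫ t in (0 : ℝ)..s, g t) + ∫ t in (0 : ℝ)..s, g t * t,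
    fun s => A - ∫ t in (0 : ℝ)..s, g t, fun t => ?_, fun t => ?_, fun s hs => ?_⟩
  · have h1 := (((hasDerivAt_id' t).mul_const A).sub
      ((hasDerivAt_id' t).mul (hprim g hg t))).add (hprim (fun t => g t * t) (by fun_prop) t)
    refine h1.congr_deriv ?_
    ring
  · simpa using (hprim g hg t).const_sub A
  · have hi : ∀ (h : ℝ → ℝ), Continuous h → ∀ a b, IntervalIntegrable h volume a b :=
      fun h hh a b => hh.intervalIntegrable a b
    have e1 : (∫ t in (0 : ℝ)..1, g t * (min s t - s * t)) =
        (∫ t in (0 : ℝ)..s, g t * (min s t - s * t)) +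
          ∫ t in s..1, g t * (min s t - s * t) :=
      (intervalIntegral.integral_add_adjacent_intervals (hi _ (by fun_prop) _ _)
        (hi _ (by fun_prop) _ _)).symm
    have e2 : (∫ t in (0 : ℝ)..s, g t * (min s t - s * t)) =
        ∫ t in (0 : ℝ)..s, (s * (g t * (1 - t)) - s * g t + g t * t) := by
      refine intervalIntegral.integral_congr fun t ht => ?_
      rw [uIcc_of_le hs.1] at ht
      simp only [min_eq_right ht.2]
      ring
    have e3 : (∫ t in s..1, g t * (min s t - s * t)) =
        ∫ t in s..1, s * (g t * (1 - t)) := by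
      refine intervalIntegral.integral_congr fun t ht => ?_
      rw [uIcc_of_le hs.2] at ht
      simp only [min_eq_left ht.1]
      ring
    have e4 : A = (∫ t in (0 : ℝ)..s, g t * (1 - t)) + ∫ t in s..1, g t * (1 - t) :=
      (intervalIntegral.integral_add_adjacent_intervals (hi _ (by fun_prop) _ _)
        (hi _ (by fun_prop) _ _)).symm
    rw [e1, e2, e3, intervalIntegral.integral_add (hi _ (by fun_prop) _ _)
      (hi _ (by fun_prop) _ _), intervalIntegral.integral_sub (hi _ (by fun_prop) _ _)
      (hi _ (by fun_prop) _ _), intervalIntegral.integral_const_mul,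
      intervalIntegral.integral_const_mul, intervalIntegral.integral_const_mul, e4]
    ring

theorem eq_two_mul_of_primitive_eq {g G : ℝ → ℝ} (hG : ∀ x, HasDerivAt G (g x) x) {b c : ℝ}
    (h : ∀ ξ ∈ Ioc (0 : ℝ) b, G ξ / ξ ^ 2 = c) {ξ : ℝ} (hξ : ξ ∈ Ioo (0 : ℝ) b) :
    g ξ = 2 * c * ξ := by
  have h1 : HasDerivAt (fun x : ℝ => c * x ^ 2) (c * (2 * ξ)) ξ := by
    simpa using (hasDerivAt_pow 2 ξ).const_mul c
  have h2 : G =ᶠ[𝓝 ξ] fun x => c * x ^ 2 := by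
    filter_upwards [Ioo_mem_nhds hξ.1 hξ.2] with x hx
    have hx0 : x ^ 2 ≠ 0 := pow_ne_zero _ hx.1.ne'
    rw [← h x ⟨hx.1, hx.2.le⟩, div_mul_cancel₀ _ hx0]
  have := (hG ξ).unique (h1.congr_of_eventuallyEq h2)
  linarith

/-- A function vanishing at `0` is bounded by the energy. -/
theorem lt_of_integral_sq_lt {u d d2 : ℝ → ℝ} {b : ℝ} (hb : 0 < b)
    (hu : ∀ t ∈ Icc (0 : ℝ) 1, HasDerivWithinAt u (d t) (Icc 0 1) t)
    (hd : ∀ t ∈ Icc (0 : ℝ) 1, HasDerivWithinAt d (d2 t) (Icc 0 1) t) (hu0 : u 0 = 0)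
    (hlt : (∫ t in (0 : ℝ)..1, |d t| ^ 2) < b ^ 2) {t : ℝ} (ht : t ∈ Icc (0 : ℝ) 1) :
    u t < b := by
  have hdc : ContinuousOn d (Icc 0 1) := fun x hx => (hd x hx).continuousWithinAt
  have huc : ContinuousOn u (Icc 0 1) := fun x hx => (hu x hx).continuousWithinAt
  have hsub : Icc (0 : ℝ) t ⊆ Icc 0 1 := Icc_subset_Icc_right ht.2
  have e1 : ∫ x in (0 : ℝ)..t, d x = u t - u 0 :=
    intervalIntegral.integral_eq_sub_of_hasDerivAt_of_le ht.1 (huc.mono hsub)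
      (fun x hx => (hu x (hsub (Ioo_subset_Icc_self hx))).hasDerivAt
        (Icc_mem_nhds hx.1 (hx.2.trans_le ht.2)))
      ((hdc.mono hsub).intervalIntegrable_of_Icc ht.1)
  have hm : ContinuousOn (fun x => |d x| ^ 2 / (2 * b) + b / 2) (Icc 0 1) :=
    ((hdc.abs.pow 2).div_const _).add continuousOn_const
  have e2 : ∫ x in (0 : ℝ)..t, d x ≤ ∫ x in (0 : ℝ)..t, (|d x| ^ 2 / (2 * b) + b / 2) := by
    refine intervalIntegral.integral_mono_on ht.1
      ((hdc.mono hsub).intervalIntegrable_of_Icc ht.1)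
      ((hm.mono hsub).intervalIntegrable_of_Icc ht.1) fun x _ => ?_
    rw [sq_abs, ← sub_nonneg]
    have : d x ^ 2 / (2 * b) + b / 2 - d x = (d x - b) ^ 2 / (2 * b) := by
      field_simp
      ring
    rw [this]
    positivity
  have e3 : ∫ x in (0 : ℝ)..t, (|d x| ^ 2 / (2 * b) + b / 2) ≤
      ∫ x in (0 : ℝ)..1, (|d x| ^ 2 / (2 * b) + b / 2) := by
    refine intervalIntegral.integral_mono_interval le_rfl ht.1 ht.2
      (Eventually.of_forall fun x => ?_) (hm.intervalIntegrable_of_Icc zero_le_one)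
    simp only [Pi.zero_apply]
    positivity
  have e4 : ∫ x in (0 : ℝ)..1, (|d x| ^ 2 / (2 * b) + b / 2) =
      (∫ x in (0 : ℝ)..1, |d x| ^ 2) / (2 * b) + b / 2 := by
    have hi : IntervalIntegrable (fun x => |d x| ^ 2 / (2 * b)) volume 0 1 :=
      ((hdc.abs.pow 2).div_const _).intervalIntegrable_of_Icc zero_le_one
    rw [intervalIntegral.integral_add hi intervalIntegrable_const,
      intervalIntegral.integral_div]
    simp
  have e5 : (∫ x in (0 : ℝ)..1, |d x| ^ 2) / (2 * b) < b / 2 := by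
    rw [div_lt_iff₀ (by positivity)]
    nlinarith
  rw [hu0] at e1
  linarith

/-- The linear problem has positive solutions for at most one value of the parameter. -/
theorem eigenvalue_unique {α : ℝ → ℝ} (hα_pos : ∀ t ∈ Icc (0 : ℝ) 1, 0 < α t) {m l₁ l₂ : ℝ}
    (hm : 0 ≤ m) (hl : l₁ < l₂) {u₁ d₁ e₁ u₂ d₂ e₂ : ℝ → ℝ}
    (hu₁ : ∀ t ∈ Icc (0 : ℝ) 1, HasDerivWithinAt u₁ (d₁ t) (Icc 0 1) t)
    (hd₁ : ∀ t ∈ Icc (0 : ℝ) 1, HasDerivWithinAt d₁ (e₁ t) (Icc 0 1) t)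
    (he₁ : ∀ t ∈ Ioo (0 : ℝ) 1, -e₁ t = l₁ * α t * (m * u₁ t))
    (hp₁ : ∀ t ∈ Ioo (0 : ℝ) 1, 0 < u₁ t) (h₁0 : u₁ 0 = 0) (h₁1 : u₁ 1 = 0)
    (hu₂ : ∀ t ∈ Icc (0 : ℝ) 1, HasDerivWithinAt u₂ (d₂ t) (Icc 0 1) t)
    (hd₂ : ∀ t ∈ Icc (0 : ℝ) 1, HasDerivWithinAt d₂ (e₂ t) (Icc 0 1) t)
    (he₂ : ∀ t ∈ Ioo (0 : ℝ) 1, -e₂ t = l₂ * α t * (m * u₂ t))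
    (hp₂ : ∀ t ∈ Ioo (0 : ℝ) 1, 0 < u₂ t) (h₂0 : u₂ 0 = 0) (h₂1 : u₂ 1 = 0) : False := by
  have hn : ∀ x ∈ Ioo (0 : ℝ) 1, Icc (0 : ℝ) 1 ∈ 𝓝 x := fun x hx => Icc_mem_nhds hx.1 hx.2
  have hcu₁ : ContinuousOn u₁ (Icc 0 1) := fun x hx => (hu₁ x hx).continuousWithinAt
  have hcd₁ : ContinuousOn d₁ (Icc 0 1) := fun x hx => (hd₁ x hx).continuousWithinAt
  have hcu₂ : ContinuousOn u₂ (Icc 0 1) := fun x hx => (hu₂ x hx).continuousWithinAt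
  have hcd₂ : ContinuousOn d₂ (Icc 0 1) := fun x hx => (hd₂ x hx).continuousWithinAt
  have hI : ∀ x ∈ Ioo (0 : ℝ) 1, x ∈ Icc (0 : ℝ) 1 := fun x hx => Ioo_subset_Icc_self hx
  have hm' : m ≠ 0 := by
    rintro rfl
    have hhalf := hp₁ (1 / 2) (by norm_num)
    obtain ⟨x, hx, hx'⟩ := exists_hasDerivAt_eq_slope u₁ d₁ (show (0 : ℝ) < 1 / 2 by norm_num)
      (hcu₁.mono (Icc_subset_Icc_right (by norm_num))) fun x hx =>
        (hu₁ x ⟨hx.1.le, by linarith [hx.2]⟩).hasDerivAt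
          (hn x ⟨hx.1, by linarith [hx.2]⟩)
    obtain ⟨y, hy, hy'⟩ := exists_hasDerivAt_eq_slope u₁ d₁ (show (1 / 2 : ℝ) < 1 by norm_num)
      (hcu₁.mono (Icc_subset_Icc_left (by norm_num))) fun x hx =>
        (hu₁ x ⟨by linarith [hx.1], hx.2.le⟩).hasDerivAt
          (hn x ⟨by linarith [hx.1], hx.2⟩)
    have hxy : x < y := hx.2.trans hy.1
    obtain ⟨z, hz, hz'⟩ := exists_hasDerivAt_eq_slope d₁ e₁ hxy
      (hcd₁.mono (Icc_subset_Icc hx.1.le hy.2.le)) fun z hz =>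
        (hd₁ z ⟨(hx.1.trans hz.1).le, (hz.2.trans hy.2).le⟩).hasDerivAt
          (hn z ⟨hx.1.trans hz.1, hz.2.trans hy.2⟩)
    have hez := he₁ z ⟨hx.1.trans hz.1, hz.2.trans hy.2⟩
    have hez0 : e₁ z = 0 := by linarith
    rw [hez0, eq_comm, div_eq_zero_iff] at hz'
    rw [h₁0] at hx'
    rw [h₁1] at hy'
    norm_num at hx' hy'
    rcases hz' with h | h <;> linarith
  have hmpos : 0 < m := lt_of_le_of_ne hm hm'.symm
  obtain ⟨z, hz, hz'⟩ := exists_hasDerivAt_eq_zero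
    (f := fun t => u₁ t * d₂ t - u₂ t * d₁ t)
    (f' := fun t => (d₁ t * d₂ t + u₁ t * e₂ t) - (d₂ t * d₁ t + u₂ t * e₁ t))
    (zero_lt_one' ℝ) ((hcu₁.mul hcd₂).sub (hcu₂.mul hcd₁)) (by simp [h₁0, h₁1, h₂0, h₂1])
    fun x hx => (((hu₁ x (hI x hx)).hasDerivAt (hn x hx)).mul
      ((hd₂ x (hI x hx)).hasDerivAt (hn x hx))).sub
        (((hu₂ x (hI x hx)).hasDerivAt (hn x hx)).mul ((hd₁ x (hI x hx)).hasDerivAt (hn x hx)))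
  have h1 := he₁ z hz
  have h2 := he₂ z hz
  have hpos : 0 < (l₂ - l₁) * α z * m * u₁ z * u₂ z := by
    have := hp₁ z hz
    have := hp₂ z hz
    have := hα_pos z (hI z hz)
    have := sub_pos.2 hl
    positivity
  have e1 : e₁ z = -(l₁ * α z * (m * u₁ z)) := by linarith
  have e2 : e₂ z = -(l₂ * α z * (m * u₂ z)) := by linarith
  simp only [e1, e2] at hz'
  nlinarith

section Energy

variable {H : Type*} [NormedAddCommGroup H] [InnerProductSpace ℝ H]

theorem tendsto_integral_mul_comp_inner {k : ℝ → H} (hk : Continuous k) (hk1 : ∀ t, ‖k t‖ ≤ 1)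
    {β G : ℝ → ℝ} (hβ : Continuous β) (hG : Continuous G) {R : ℝ} {v : ℕ → H} {w : H}
    (hv : ∀ n, ‖v n‖ ≤ R) (hlim : ∀ h, Tendsto (fun n => ⟪v n, h⟫) atTop (𝓝 ⟪w, h⟫)) :
    Tendsto (fun n => ∫ t in (0 : ℝ)..1, β t * G ⟪k t, v n⟫) atTop
      (𝓝 (∫ t in (0 : ℝ)..1, β t * G ⟪k t, w⟫)) := by
  obtain ⟨C, hC⟩ := (isCompact_Icc (a := -R) (b := R)).exists_bound_of_continuousOn hG.continuousOn
  refine intervalIntegral.tendsto_integral_filter_of_dominated_convergence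
    (fun t => |β t| * C) (Eventually.of_forall fun n => ?_)
    (Eventually.of_forall fun n => Eventually.of_forall fun t _ => ?_)
    (Continuous.intervalIntegrable (by fun_prop) _ _) (Eventually.of_forall fun t _ => ?_)
  · have : Continuous fun t => β t * G ⟪k t, v n⟫ := by fun_prop
    exact this.aestronglyMeasurable
  · rw [norm_mul, Real.norm_eq_abs]
    refine mul_le_mul_of_nonneg_left (hC _ (abs_le.1 ?_)) (abs_nonneg _)
    refine (abs_real_inner_le_norm _ _).trans ?_
    nlinarith [hk1 t, hv n, norm_nonneg (k t), norm_nonneg (v n)]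
  · have h1 := (hG.tendsto _).comp (hlim (k t))
    refine Tendsto.const_mul _ ?_
    simpa only [real_inner_comm, Function.comp_def] using h1

theorem hasDerivAt_integral_mul_comp_inner {k : ℝ → H} (hk : Continuous k)
    {β g G : ℝ → ℝ} (hβ : Continuous β) (hg : Continuous g) (hG : ∀ x, HasDerivAt G (g x) x)
    (v h : H) :
    HasDerivAt (fun ε : ℝ => ∫ t in (0 : ℝ)..1, β t * G ⟪k t, v + ε • h⟫)
      (∫ t in (0 : ℝ)..1, β t * g ⟪k t, v⟫ * ⟪k t, h⟫) 0 := by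
  have hGc : Continuous G := continuous_iff_continuousAt.2 fun x => (hG x).continuousAt
  let Φ' : ℝ → ℝ → ℝ := fun ε t => β t * (g ⟪k t, v + ε • h⟫ * ⟪k t, h⟫)
  have hΦ' : Continuous (Function.uncurry Φ') := by
    simp only [Φ', Function.uncurry_def]
    fun_prop
  obtain ⟨C, hC⟩ := ((isCompact_Icc (a := (-1 : ℝ)) (b := 1)).prod
    (isCompact_Icc (a := (0 : ℝ)) (b := 1))).exists_bound_of_continuousOn hΦ'.continuousOn
  have key := (intervalIntegral.hasDerivAt_integral_of_dominated_loc_of_deriv_le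
    (μ := volume) (a := 0) (b := 1) (F := fun ε t => β t * G ⟪k t, v + ε • h⟫) (F' := Φ')
    (x₀ := 0) (s := Icc (-1) 1) (bound := fun _ => C) (Icc_mem_nhds (by norm_num) (by norm_num))
    (Eventually.of_forall fun ε => Continuous.aestronglyMeasurable (by fun_prop))
    (Continuous.intervalIntegrable (by fun_prop) _ _)
    (Continuous.aestronglyMeasurable (by fun_prop))
    (Eventually.of_forall fun t ht ε hε => hC (ε, t) ⟨hε, ?_⟩) intervalIntegrable_const
    (Eventually.of_forall fun t _ ε _ => ?_)).2
  · refine key.congr_deriv ?_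
    simp only [Φ', zero_smul, add_zero, mul_assoc]
  · rw [uIoc_of_le zero_le_one] at ht
    exact Ioc_subset_Icc_self ht
  · have h1 : HasDerivAt (fun ε : ℝ => ⟪k t, v + ε • h⟫) ⟪k t, h⟫ ε := by
      simp only [inner_add_right, real_inner_smul_right]
      simpa using ((hasDerivAt_id' ε).mul_const ⟪k t, h⟫).const_add ⟪k t, v⟫
    exact ((hG _).comp ε h1).const_mul (β t)

/-- The Euler-Lagrange equation at an interior minimum point. -/
theorem inner_eq_of_isMinOn {k : ℝ → H} (hk : Continuous k)
    {β g G : ℝ → ℝ} (hβ : Continuous β) (hg : Continuous g) (hG : ∀ x, HasDerivAt G (g x) x)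
    {R l : ℝ} {v : H} (hv : ‖v‖ < R)
    (hmin : ∀ w, ‖w‖ ≤ R → 1 / 2 * ‖v‖ ^ 2 - l * (∫ t in (0 : ℝ)..1, β t * G ⟪k t, v⟫) ≤
      1 / 2 * ‖w‖ ^ 2 - l * ∫ t in (0 : ℝ)..1, β t * G ⟪k t, w⟫) (h : H) :
    ⟪v, h⟫ = ∫ t in (0 : ℝ)..1, l * (β t * g ⟪k t, v⟫) * ⟪k t, h⟫ := by
  have h1 : HasDerivAt (fun ε : ℝ => 1 / 2 * ‖v + ε • h‖ ^ 2) ⟪v, h⟫ 0 := by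
    have h2 : HasDerivAt (fun ε : ℝ => v + ε • h) h 0 := by
      simpa using ((hasDerivAt_id' (0 : ℝ)).smul_const h).const_add v
    refine (h2.norm_sq.const_mul (1 / 2)).congr_deriv ?_
    simp
  have h3 := h1.sub ((hasDerivAt_integral_mul_comp_inner hk hβ hg hG v h).const_mul l)
  have hloc : IsLocalMin ((fun ε : ℝ => 1 / 2 * ‖v + ε • h‖ ^ 2) -
      fun ε : ℝ => l * ∫ t in (0 : ℝ)..1, β t * G ⟪k t, v + ε • h⟫) 0 := by
    have hc : Continuous fun ε : ℝ => ‖v + ε • h‖ := by fun_prop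
    have hev : ∀ᶠ ε : ℝ in 𝓝 0, ‖v + ε • h‖ < R :=
      hc.continuousAt.eventually_lt continuousAt_const (by simpa using hv)
    filter_upwards [hev] with ε hε
    have := hmin (v + ε • h) hε.le
    simpa using this
  have h4 := hloc.hasDerivAt_eq_zero h3
  rw [sub_eq_zero] at h4
  rw [h4, ← intervalIntegral.integral_const_mul]
  simp only [mul_assoc]

/-- If the quotient `G ξ / ξ ^ 2` is non-increasing but not constant near `0`, then the energy
does not attain its best quadratic bound on the sphere. -/
theorem exists_bound_mul_sq_norm_lt [CompleteSpace H] [TopologicalSpace.SeparableSpace H]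
    {k : ℝ → H} (hk : Continuous k)
    (hk1 : ∀ t, ‖k t‖ ≤ 1)
    (hgreen : ∀ s ∈ Icc (0 : ℝ) 1, ∀ t ∈ Icc (0 : ℝ) 1, ⟪k s, k t⟫ = min s t - s * t)
    {β G : ℝ → ℝ} (hβ : Continuous β) (hβ_pos : ∀ t, 0 < β t) (hG : Continuous G)
    (hG_mono : Monotone G) (hG0 : ∀ x ≤ 0, G x = 0) {a R : ℝ} (hR : 0 < R) (hRa : R ≤ a)
    (hmono : ∀ ξ₁ ξ₂, 0 < ξ₁ → ξ₁ ≤ ξ₂ → ξ₂ ≤ a → G ξ₂ / ξ₂ ^ 2 ≤ G ξ₁ / ξ₁ ^ 2)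
    (hnc : ∀ b > (0 : ℝ), ¬ ∃ c : ℝ, ∀ ξ ∈ Ioc (0 : ℝ) b, G ξ / ξ ^ 2 = c) :
    ∃ (M : ℝ) (w : H), (∀ v : H, ‖v‖ ≤ R → ∫ t in (0 : ℝ)..1, β t * G ⟪k t, v⟫ ≤ M) ∧
      ‖w‖ ≤ R ∧ M * ‖w‖ ^ 2 < (∫ t in (0 : ℝ)..1, β t * G ⟪k t, w⟫) * R ^ 2 := by
  have hin : ∀ v : H, ‖v‖ ≤ R → ∀ t, ⟪k t, v⟫ ≤ R := by
    intro v hv t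
    refine (real_inner_le_norm _ _).trans ?_
    nlinarith [hk1 t, norm_nonneg (k t), norm_nonneg v]
  have hGnn : ∀ x, 0 ≤ G x := fun x => by
    rcases le_total x 0 with hx | hx
    · exact (hG0 x hx).ge
    · exact (hG0 0 le_rfl).ge.trans (hG_mono hx)
  have hcont : ∀ v : H, Continuous fun t => β t * G ⟪k t, v⟫ := fun v => by fun_prop
  set J : H → ℝ := fun v => ∫ t in (0 : ℝ)..1, β t * G ⟪k t, v⟫ with hJ
  have hJnn : ∀ v, 0 ≤ J v := fun v => intervalIntegral.integral_nonneg zero_le_one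
    fun t _ => mul_nonneg (hβ_pos t).le (hGnn _)
  obtain ⟨v₁, hv₁, hmax₁⟩ := exists_isMinOn_sq_norm_sub (H := H) hR.le (J := J) (c := 0)
    (C := ∫ t in (0 : ℝ)..1, β t * G R) le_rfl
    (fun v hv => intervalIntegral.integral_mono_on zero_le_one ((hcont v).intervalIntegrable _ _)
      (Continuous.intervalIntegrable (by fun_prop) _ _) fun t _ =>
        mul_le_mul_of_nonneg_left (hG_mono (hin v hv t)) (hβ_pos t).le)
    (fun v w hv hlim => tendsto_integral_mul_comp_inner hk hk1 hβ hG hv hlim)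
  simp only [zero_mul, zero_sub, neg_le_neg_iff] at hmax₁
  obtain ⟨v, hv, hmax, t₀, ht₀, hpos⟩ : ∃ v, ‖v‖ ≤ R ∧ (∀ w, ‖w‖ ≤ R → J w ≤ J v) ∧
      ∃ t ∈ Icc (0 : ℝ) 1, 0 < ⟪k t, v⟫ := by
    by_cases hcase : ∃ t ∈ Icc (0 : ℝ) 1, 0 < ⟪k t, v₁⟫
    · exact ⟨v₁, hv₁, hmax₁, hcase⟩
    · push Not at hcase
      have hzero : J v₁ = 0 := by
        simp only [hJ]
        refine (intervalIntegral.integral_congr (g := fun _ => (0 : ℝ)) fun t ht => ?_).trans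
          (by simp)
        rw [uIcc_of_le zero_le_one] at ht
        simp only [hG0 _ (hcase t ht), mul_zero]
      refine ⟨R • k (1 / 2), ?_, fun w hw => ?_, 1 / 2, by norm_num, ?_⟩
      · rw [norm_smul, Real.norm_of_nonneg hR.le]
        nlinarith [hk1 (1 / 2)]
      · exact (hmax₁ w hw).trans (hzero.le.trans (hJnn _))
      · rw [real_inner_smul_right, hgreen _ (by norm_num) _ (by norm_num)]
        norm_num
        exact hR
  refine ⟨J v, ?_⟩
  by_contra! hcon
  have hscale : ∀ s ∈ Ioc (0 : ℝ) 1, ∀ x ≤ R, s ^ 2 * G x ≤ G (s * x) := by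
    intro s hs x hx
    rcases le_or_gt x 0 with hx0 | hx0
    · rw [hG0 x hx0, mul_zero]
      exact hGnn _
    · have h1 := hmono (s * x) x (mul_pos hs.1 hx0) (by nlinarith [hs.2]) (hx.trans hRa)
      rw [div_le_div_iff₀ (by positivity) (pow_pos (mul_pos hs.1 hx0) 2)] at h1
      have h2 : 0 < x ^ 2 := by positivity
      nlinarith
  have heq : ∀ s ∈ Ioc (0 : ℝ) 1, G (s * ⟪k t₀, v⟫) = s ^ 2 * G ⟪k t₀, v⟫ := by
    intro s hs
    by_contra hne
    have hlt : s ^ 2 * G ⟪k t₀, v⟫ < G (s * ⟪k t₀, v⟫) :=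
      lt_of_le_of_ne (hscale s hs _ (hin v hv t₀)) (Ne.symm hne)
    have hsv : ‖s • v‖ ≤ R := by
      rw [norm_smul, Real.norm_of_nonneg hs.1.le]
      nlinarith [hs.2, norm_nonneg v, hs.1]
    have h1 : s ^ 2 * J v < J (s • v) := by
      simp only [hJ, ← intervalIntegral.integral_const_mul]
      refine intervalIntegral.integral_lt_integral_of_continuousOn_of_le_of_exists_lt
        zero_lt_one (by fun_prop) (by fun_prop) (fun t _ => ?_) ⟨t₀, ht₀, ?_⟩
      · rw [real_inner_smul_right]
        nlinarith [hscale s hs _ (hin v hv t), hβ_pos t]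
      · rw [real_inner_smul_right]
        nlinarith [hβ_pos t₀]
    have h2 := hcon (s • v) hmax hsv
    rw [norm_smul, Real.norm_of_nonneg hs.1.le, mul_pow] at h2
    have h3 : ‖v‖ ^ 2 ≤ R ^ 2 := by gcongr
    have h4 : J v * (s ^ 2 * ‖v‖ ^ 2) ≤ J v * (s ^ 2 * R ^ 2) := by
      have := hJnn v
      gcongr
    have h5 : 0 < R ^ 2 := by positivity
    nlinarith [mul_lt_mul_of_pos_right h1 h5]
  refine hnc _ hpos ⟨G ⟪k t₀, v⟫ / ⟪k t₀, v⟫ ^ 2, fun ξ hξ => ?_⟩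
  have h1 := heq (ξ / ⟪k t₀, v⟫) ⟨div_pos hξ.1 hpos, (div_le_one hpos).2 hξ.2⟩
  have hne := hpos.ne'
  have hξne := hξ.1.ne'
  rw [div_mul_cancel₀ _ hne] at h1
  rw [h1]
  field_simp

/-- Existence of a positive solution with small energy. -/
theorem exists_solution_of_energy [CompleteSpace H] [TopologicalSpace.SeparableSpace H]
    {k : ℝ → H} (hk : Continuous k)
    (hk1 : ∀ t, ‖k t‖ ≤ 1)
    (hgreen : ∀ s ∈ Icc (0 : ℝ) 1, ∀ t ∈ Icc (0 : ℝ) 1, ⟪k s, k t⟫ = min s t - s * t)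
    {β g G : ℝ → ℝ} (hβ : Continuous β) (hβ_pos : ∀ t, 0 < β t) (hg : Continuous g)
    (hg_nonneg : ∀ x, 0 ≤ g x) (hG : ∀ x, HasDerivAt G (g x) x)
    (hG0 : G 0 = 0) {R M l : ℝ} (hl : 0 < l) {w : H}
    (hM : ∀ v : H, ‖v‖ ≤ R → ∫ t in (0 : ℝ)..1, β t * G ⟪k t, v⟫ ≤ M) (hw : ‖w‖ ≤ R)
    (hlM : l * M < R ^ 2 / 2)
    (hlw : ‖w‖ ^ 2 / 2 < l * ∫ t in (0 : ℝ)..1, β t * G ⟪k t, w⟫) :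
    ∃ u d d2 : ℝ → ℝ, (∀ t, HasDerivAt u (d t) t) ∧ (∀ t, HasDerivAt d (d2 t) t) ∧
      Continuous d2 ∧ (∀ t ∈ Icc (0 : ℝ) 1, -d2 t = l * β t * g (u t)) ∧
      (∀ t ∈ Icc (0 : ℝ) 1, 0 ≤ u t) ∧ (∀ t ∈ Ioo (0 : ℝ) 1, 0 < u t) ∧ u 0 = 0 ∧ u 1 = 0 ∧
      ∫ t in (0 : ℝ)..1, |d t| ^ 2 < R ^ 2 := by
  have hGc : Continuous G := continuous_iff_continuousAt.2 fun x => (hG x).continuousAt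
  have hR : 0 ≤ R := (norm_nonneg w).trans hw
  obtain ⟨v, hv, hmin⟩ := exists_isMinOn_sq_norm_sub (H := H) hR
    (J := fun v => l * ∫ t in (0 : ℝ)..1, β t * G ⟪k t, v⟫) (c := 1 / 2) (C := l * M)
    (by norm_num) (fun v hv => mul_le_mul_of_nonneg_left (hM v hv) hl.le)
    (fun v w hv hlim =>
      (tendsto_integral_mul_comp_inner hk hk1 hβ hGc hv hlim).const_mul l)
  have hneg := hmin w hw
  have hvR : ‖v‖ < R := by
    refine lt_of_le_of_ne hv fun h => ?_
    have := mul_le_mul_of_nonneg_left (hM v hv) hl.le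
    rw [h] at hneg
    linarith
  have hEL := inner_eq_of_isMinOn hk hβ hg hG hvR hmin
  set p : ℝ → ℝ := fun t => l * (β t * g ⟪k t, v⟫) with hp
  have hpc : Continuous p := by fun_prop
  have hpnn : ∀ t, 0 ≤ p t := fun t => by
    have := hβ_pos t
    have := hg_nonneg ⟪k t, v⟫
    positivity
  obtain ⟨U, D, hU, hD, hUG⟩ := exists_hasDerivAt_of_green hpc
  have hUk : ∀ s ∈ Icc (0 : ℝ) 1, U s = ⟪k s, v⟫ := by
    intro s hs
    rw [hUG s hs, real_inner_comm, hEL (k s)]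
    refine intervalIntegral.integral_congr fun t ht => ?_
    rw [uIcc_of_le zero_le_one] at ht
    simp only [hp, hgreen t ht s hs, min_comm t s, mul_comm t s]
  have hg0 : ∀ s ∈ Icc (0 : ℝ) 1, ∀ t ∈ Icc (0 : ℝ) 1, 0 ≤ min s t - s * t := by
    intro s hs t ht
    rcases le_total s t with h | h
    · rw [min_eq_left h]
      nlinarith [hs.1, ht.2]
    · rw [min_eq_right h]
      nlinarith [hs.2, ht.1]
  have hU0 : U 0 = 0 := by
    rw [hUG 0 (by simp)]
    refine (intervalIntegral.integral_congr (g := fun _ => (0 : ℝ)) fun t ht => ?_).trans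
      (by simp)
    rw [uIcc_of_le zero_le_one] at ht
    simp [min_eq_left ht.1]
  have hU1 : U 1 = 0 := by
    rw [hUG 1 (by simp)]
    refine (intervalIntegral.integral_congr (g := fun _ => (0 : ℝ)) fun t ht => ?_).trans
      (by simp)
    rw [uIcc_of_le zero_le_one] at ht
    simp [min_eq_right ht.2]
  have hUc : Continuous U := continuous_iff_continuousAt.2 fun x => (hU x).continuousAt
  have hDc : Continuous D := continuous_iff_continuousAt.2 fun x => (hD x).continuousAt
  have hnorm : ‖v‖ ^ 2 = ∫ t in (0 : ℝ)..1, p t * U t := by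
    rw [← real_inner_self_eq_norm_sq, hEL v]
    refine intervalIntegral.integral_congr fun t ht => ?_
    rw [uIcc_of_le zero_le_one] at ht
    simp only [hp, hUk t ht]
  have hUnn : ∀ s ∈ Icc (0 : ℝ) 1, 0 ≤ U s := fun s hs => by
    rw [hUG s hs]
    exact intervalIntegral.integral_nonneg zero_le_one fun t ht =>
      mul_nonneg (hpnn t) (hg0 s hs t ht)
  have hv0 : v ≠ 0 := by
    rintro rfl
    simp only [inner_zero_right, hG0, norm_zero, mul_zero, intervalIntegral.integral_zero] at hneg
    linarith
  refine ⟨U, D, fun t => -p t, hU, hD, hpc.neg, fun t ht => ?_, hUnn, fun s hs => ?_, hU0, hU1,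
    ?_⟩
  · rw [neg_neg, hUk t ht, hp, mul_assoc]
  · refine lt_of_le_of_ne (hUnn s (Ioo_subset_Icc_self hs)) fun h => ?_
    have hp0 : ∀ t ∈ Ioo (0 : ℝ) 1, p t = 0 := by
      intro t ht
      by_contra hne
      have hlt : ∫ t in (0 : ℝ)..1, (0 : ℝ) < ∫ t in (0 : ℝ)..1, p t * (min s t - s * t) := by
        refine intervalIntegral.integral_lt_integral_of_continuousOn_of_le_of_exists_lt
          zero_lt_one (by fun_prop) (by fun_prop) (fun t ht => mul_nonneg (hpnn t)
            (hg0 s (Ioo_subset_Icc_self hs) t (Ioc_subset_Icc_self ht)))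
          ⟨t, Ioo_subset_Icc_self ht, mul_pos (lt_of_le_of_ne (hpnn t) (Ne.symm hne)) ?_⟩
        rcases le_total s t with h | h
        · rw [min_eq_left h]
          nlinarith [hs.1, ht.2]
        · rw [min_eq_right h]
          nlinarith [hs.2, ht.1]
      rw [← hUG s (Ioo_subset_Icc_self hs), ← h] at hlt
      simp at hlt
    have hcl : ∀ t ∈ Icc (0 : ℝ) 1, p t * U t = 0 := by
      intro t ht
      rcases eq_endpoints_or_mem_Ioo_of_mem_Icc ht with rfl | rfl | h'
      · rw [hU0, mul_zero]
      · rw [hU1, mul_zero]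
      · rw [hp0 t h', zero_mul]
    have : ‖v‖ ^ 2 = 0 := by
      rw [hnorm]
      refine (intervalIntegral.integral_congr (g := fun _ => (0 : ℝ)) fun t ht => ?_).trans
        (by simp)
      rw [uIcc_of_le zero_le_one] at ht
      exact hcl t ht
    exact hv0 (by simpa using this)
  · have hparts := intervalIntegral.integral_mul_deriv_eq_deriv_mul (a := 0) (b := 1)
      (fun x _ => hU x) (fun x _ => hD x) (hDc.intervalIntegrable _ _)
      (hpc.neg.intervalIntegrable _ _)
    rw [hU0, hU1] at hparts
    have h1 : ∫ t in (0 : ℝ)..1, |D t| ^ 2 = ∫ t in (0 : ℝ)..1, D t * D t := by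
      simp only [sq_abs, ← sq]
    have h2 : ∫ t in (0 : ℝ)..1, U t * -p t = -∫ t in (0 : ℝ)..1, p t * U t := by
      rw [← intervalIntegral.integral_neg]
      congr 1
      ext t
      ring
    rw [h2] at hparts
    have h3 : ∫ t in (0 : ℝ)..1, |D t| ^ 2 = ‖v‖ ^ 2 := by
      rw [h1, hnorm]
      linarith
    rw [h3]
    gcongr

end Energy

end DirichletProblem

theorem stmt0
    (f α : ℝ → ℝ)
    (hf_cont : ContinuousOn f (Ici 0))
    (hf_nonneg : ∀ ξ ∈ Ici (0:ℝ), 0 ≤ f ξ)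
    (hf0 : f 0 = 0)
    (hα_cont : ContinuousOn α (Icc 0 1))
    (hα_pos : ∀ t ∈ Icc (0:ℝ) 1, 0 < α t)
    (F : ℝ → ℝ) (hF : ∀ ξ, F ξ = ∫ t in (0:ℝ)..ξ, f t)
    (a : ℝ) (ha : 0 < a)
    (hmono : ∀ ξ₁ ξ₂, 0 < ξ₁ → ξ₁ ≤ ξ₂ → ξ₂ ≤ a → F ξ₂ / ξ₂ ^ 2 ≤ F ξ₁ / ξ₁ ^ 2) :
    ((∀ b > (0:ℝ), ¬ ∃ c : ℝ, ∀ ξ ∈ Ioc (0:ℝ) b, F ξ / ξ ^ 2 = c) ↔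
      (∀ r > (0:ℝ), ∃ p q : ℝ, 0 ≤ p ∧ p < q ∧ ∀ lam ∈ Ioo p q,
        ∃ u d d2 : ℝ → ℝ,
          (∀ t ∈ Icc (0:ℝ) 1, HasDerivWithinAt u (d t) (Icc 0 1) t) ∧
          (∀ t ∈ Icc (0:ℝ) 1, HasDerivWithinAt d (d2 t) (Icc 0 1) t) ∧
          ContinuousOn d2 (Icc 0 1) ∧
          (∀ t ∈ Icc (0:ℝ) 1, -d2 t = lam * α t * f (u t)) ∧
          (∀ t ∈ Ioo (0:ℝ) 1, 0 < u t) ∧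
          u 0 = 0 ∧ u 1 = 0 ∧
          (∫ t in (0:ℝ)..1, |d t| ^ 2) < r)) := by
  have hsm : ∀ x, max x 0 ∈ Ici (0 : ℝ) := fun x => mem_Ici.2 (le_max_right x 0)
  set g : ℝ → ℝ := fun x => f (max x 0) with hg
  have hgc : Continuous g := hf_cont.comp_continuous (by fun_prop) hsm
  have hgnn : ∀ x, 0 ≤ g x := fun x => hf_nonneg _ (hsm x)
  have hgf : ∀ x, 0 ≤ x → g x = f x := fun x hx => by simp only [hg, max_eq_left hx]
  have hg0 : ∀ x ≤ 0, g x = 0 := fun x hx => by simp only [hg, max_eq_right hx, hf0]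
  set G : ℝ → ℝ := fun x => ∫ t in (0 : ℝ)..x, g t with hG
  have hGd : ∀ x, HasDerivAt G (g x) x := fun x =>
    intervalIntegral.integral_hasDerivAt_right (hgc.intervalIntegrable _ _)
      (hgc.stronglyMeasurableAtFilter _ _) hgc.continuousAt
  have hGm : Monotone G := monotone_of_hasDerivAt_nonneg hGd hgnn
  have hG0 : ∀ x ≤ 0, G x = 0 := by
    intro x hx
    refine (intervalIntegral.integral_congr (g := fun _ => (0 : ℝ)) fun t ht => ?_).trans
      (by simp)
    rw [uIcc_of_ge hx] at ht
    exact hg0 t ht.2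
  have hFG : ∀ x, 0 ≤ x → F x = G x := by
    intro x hx
    rw [hF]
    refine intervalIntegral.integral_congr fun t ht => ?_
    rw [uIcc_of_le hx] at ht
    exact (hgf t ht.1).symm
  constructor
  · intro hnc r hr
    set β : ℝ → ℝ := fun t => α (max 0 (min t 1)) with hβ
    have hcm : ∀ t : ℝ, max 0 (min t 1) ∈ Icc (0 : ℝ) 1 := fun t =>
      ⟨le_max_left _ _, max_le zero_le_one (min_le_right _ _)⟩
    have hβc : Continuous β := hα_cont.comp_continuous (by fun_prop) hcm
    have hβp : ∀ t, 0 < β t := fun t => hα_pos _ (hcm t)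
    have hβα : ∀ t ∈ Icc (0 : ℝ) 1, β t = α t := fun t ht => by
      simp only [hβ, min_eq_left ht.2, max_eq_right ht.1]
    have : Fact ((2 : ENNReal) ≠ ⊤) := ⟨ENNReal.ofNat_ne_top⟩
    obtain ⟨k, hk, hk1, hgreen⟩ := exists_continuous_inner_eq_green
    set R := min a (min r 1)
    have hR : 0 < R := lt_min ha (lt_min hr one_pos)
    have hRr : R ≤ r := (min_le_right _ _).trans (min_le_left _ _)
    have hR1 : R ≤ 1 := (min_le_right _ _).trans (min_le_right _ _)
    have hmono' : ∀ ξ₁ ξ₂, 0 < ξ₁ → ξ₁ ≤ ξ₂ → ξ₂ ≤ a →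
        G ξ₂ / ξ₂ ^ 2 ≤ G ξ₁ / ξ₁ ^ 2 := by
      intro ξ₁ ξ₂ h1 h2 h3
      rw [← hFG _ h1.le, ← hFG _ (h1.le.trans h2)]
      exact hmono ξ₁ ξ₂ h1 h2 h3
    have hnc' : ∀ b > (0 : ℝ), ¬ ∃ c : ℝ, ∀ ξ ∈ Ioc (0 : ℝ) b, G ξ / ξ ^ 2 = c := by
      rintro b hb ⟨c, hc⟩
      exact hnc b hb ⟨c, fun ξ hξ => by rw [hFG _ hξ.1.le, hc ξ hξ]⟩
    obtain ⟨M, w, hM, hw, hlt⟩ := exists_bound_mul_sq_norm_lt hk hk1 hgreen hβc hβp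
      (continuous_iff_continuousAt.2 fun x => (hGd x).continuousAt) hGm hG0 hR (min_le_left _ _)
      hmono' hnc'
    set j := ∫ t in (0 : ℝ)..1, β t * G (inner ℝ (k t) w) with hj
    have hjM : j ≤ M := hM w hw
    have hjnn : 0 ≤ j := intervalIntegral.integral_nonneg zero_le_one fun t _ =>
      mul_nonneg (hβp t).le ((hG0 _ (min_le_left 0 _)).ge.trans (hGm (min_le_right _ _)))
    have hjpos : 0 < j := by
      have : 0 ≤ M * ‖w‖ ^ 2 := mul_nonneg (hjnn.trans hjM) (sq_nonneg _)
      exact pos_of_mul_pos_left (this.trans_lt hlt) (sq_nonneg R)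
    have hMpos : 0 < M := hjpos.trans_le hjM
    refine ⟨‖w‖ ^ 2 / (2 * j), R ^ 2 / (2 * M), by positivity, ?_, fun l hl => ?_⟩
    · rw [div_lt_div_iff₀ (by positivity) (by positivity)]
      linarith
    · have hl0 : 0 < l := lt_of_le_of_lt (by positivity) hl.1
      have h1 := (div_lt_iff₀ (by positivity)).1 hl.1
      have h2 := (lt_div_iff₀ (by positivity)).1 hl.2
      obtain ⟨u, d, d2, hu, hd, hd2, heq, hunn, hup, hu0, hu1, hE⟩ :=
        exists_solution_of_energy hk hk1 hgreen hβc hβp hgc hgnn hGd (hG0 0 le_rfl) hl0 hM hw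
          (by linarith) (by rw [← hj]; linarith)
      refine ⟨u, d, d2, fun t _ => (hu t).hasDerivWithinAt, fun t _ => (hd t).hasDerivWithinAt,
        hd2.continuousOn, fun t ht => ?_, hup, hu0, hu1, hE.trans_le (by nlinarith)⟩
      rw [heq t ht, hβα t ht, hgf _ (hunn t ht)]
  · rintro hsol b hb ⟨c, hc⟩
    have hc' : ∀ ξ ∈ Ioc (0 : ℝ) b, G ξ / ξ ^ 2 = c := fun ξ hξ => by
      rw [← hFG _ hξ.1.le, hc ξ hξ]
    have hc0 : 0 ≤ c := by
      rw [← hc' b ⟨hb, le_rfl⟩]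
      exact div_nonneg ((hG0 0 le_rfl).ge.trans (hGm hb.le)) (sq_nonneg _)
    obtain ⟨p, q, -, hpq, hpqs⟩ := hsol (b ^ 2) (by positivity)
    obtain ⟨l₁, hl₁⟩ := exists_between hpq
    obtain ⟨l₂, hl₂⟩ := exists_between hl₁.2
    obtain ⟨u₁, d₁, e₁, hu₁, hd₁, -, he₁, hp₁, h₁0, h₁1, hE₁⟩ := hpqs l₁ hl₁
    obtain ⟨u₂, d₂, e₂, hu₂, hd₂, -, he₂, hp₂, h₂0, h₂1, hE₂⟩ :=
      hpqs l₂ ⟨hl₁.1.trans hl₂.1, hl₂.2⟩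
    have hlin : ∀ x ∈ Ioo (0 : ℝ) b, f x = 2 * c * x := fun x hx => by
      rw [← hgf x hx.1.le, eq_two_mul_of_primitive_eq hGd hc' hx]
    refine eigenvalue_unique hα_pos (m := 2 * c) (by positivity) hl₂.1 hu₁ hd₁ (fun t ht => ?_)
      hp₁ h₁0 h₁1 hu₂ hd₂ (fun t ht => ?_) hp₂ h₂0 h₂1
    · have ht' := Ioo_subset_Icc_self ht
      rw [he₁ t ht', hlin _ ⟨hp₁ t ht, lt_of_integral_sq_lt hb hu₁ hd₁ h₁0 hE₁ ht'⟩]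
    · have ht' := Ioo_subset_Icc_self ht
      rw [he₂ t ht', hlin _ ⟨hp₂ t ht, lt_of_integral_sq_lt hb hu₂ hd₂ h₂0 hE₂ ht'⟩]
end

section
/- Let f : [0,∞) → [0,∞) and α : [0,1] → (0,∞) be continuous functions with f(0) = 0, and set F(ξ) = ∫₀^ξ f(t) dt. Assume that for some a > 0 the function ξ ↦ F(ξ)/ξ² is non-increasing on (0,a], and that for each b > 0 the function ξ ↦ F(ξ)/ξ² is not constant on (0,b]. Then for each r > 0 there exists a nonempty open interval I ⊆ (0,∞) such that for every λ ∈ I there exists a twice continuously differentiable function u : [0,1] → ℝ satisfying −u''(t) = λ α(t) f(u(t)) for all t ∈ [0,1], u(t) > 0 for all t ∈ (0,1), u(0) = u(1) = 0, and ∫₀¹ |u'(t)|² dt < r. -/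
open Set MeasureTheory

section Hilbert

variable {H : Type*} [NormedAddCommGroup H] [InnerProductSpace ℝ H]

/-- The integral functional `v ↦ ∫₀¹ A(t) G(⟪k t, v⟫) dt`. -/
noncomputable def potential (k : ℝ → H) (A G : ℝ → ℝ) (v : H) : ℝ :=
  ∫ t in (0:ℝ)..1, A t * G (inner ℝ (k t) v)

/-- A weakly lower semicontinuous perturbation of the norm attains its minimum on a ball. -/
theorem exists_min_sub_potential [CompleteSpace H] {k : ℝ → H} (hk : Continuous k)
    {A G : ℝ → ℝ} (hA : Continuous A) (hG : Continuous G) {φ : ℝ → ℝ} (hφ : Continuous φ)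
    (hφm : Monotone φ) {R : ℝ} (hR : 0 ≤ R) :
    ∃ v : H, ‖v‖ ≤ R ∧ ∀ w : H, ‖w‖ ≤ R →
      φ ‖v‖ - potential k A G v ≤ φ ‖w‖ - potential k A G w := by
  set K : Set (WeakDual ℝ H) := WeakDual.toStrongDual ⁻¹' Metric.closedBall 0 R with hK
  have hmem : ∀ ψ : WeakDual ℝ H, ψ ∈ K ↔ ‖WeakDual.toStrongDual ψ‖ ≤ R := by
    intro ψ; simp [hK]
  have hKc : IsCompact K := WeakDual.isCompact_closedBall 0 R
  have hne : K.Nonempty := ⟨0, by rw [hmem]; simpa using hR⟩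
  have hjoint : Continuous fun p : K × ℝ => (p.1 : WeakDual ℝ H) (k p.2) := by
    rw [continuous_iff_continuousAt]
    rintro ⟨ψ₀, t₀⟩
    have h1 : Filter.Tendsto (fun p : K × ℝ => (p.1 : WeakDual ℝ H) (k p.2 - k t₀))
        (nhds (ψ₀, t₀)) (nhds 0) := by
      have hb : Filter.Tendsto (fun p : K × ℝ => R * ‖k p.2 - k t₀‖) (nhds (ψ₀, t₀)) (nhds 0) := by
        have : Continuous fun p : K × ℝ => R * ‖k p.2 - k t₀‖ := by fun_prop
        simpa using this.tendsto (ψ₀, t₀)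
      refine squeeze_zero_norm (fun p => ?_) hb
      have := (WeakDual.toStrongDual (p.1 : WeakDual ℝ H)).le_opNorm (k p.2 - k t₀)
      exact this.trans (mul_le_mul_of_nonneg_right ((hmem _).1 p.1.2) (norm_nonneg _))
    have h2 : Continuous fun p : K × ℝ => (p.1 : WeakDual ℝ H) (k t₀) :=
      (WeakDual.eval_continuous (k t₀)).comp (continuous_subtype_val.comp continuous_fst)
    have h3 := h1.add (h2.tendsto (ψ₀, t₀))
    rw [zero_add] at h3
    refine h3.congr fun p => ?_
    rw [map_sub]; ring
  have hJ : ContinuousOn (fun ψ : WeakDual ℝ H => ∫ t in (0:ℝ)..1, A t * G (ψ (k t))) K := by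
    rw [continuousOn_iff_continuous_domRestrict]
    refine intervalIntegral.continuous_parametric_intervalIntegral_of_continuous'
      (f := fun (ψ : K) t => A t * G ((ψ : WeakDual ℝ H) (k t))) ?_ 0 1
    exact (hA.comp continuous_snd).mul (hG.comp hjoint)
  have hN : LowerSemicontinuous fun ψ : WeakDual ℝ H => ‖WeakDual.toStrongDual ψ‖ := by
    rw [lowerSemicontinuous_iff_isClosed_preimage]
    intro c
    convert WeakDual.isClosed_closedBall (𝕜 := ℝ) (E := H) 0 c using 1
    ext ψ; simp
  have hL : LowerSemicontinuousOn (fun ψ : WeakDual ℝ H => φ ‖WeakDual.toStrongDual ψ‖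
      + -∫ t in (0:ℝ)..1, A t * G (ψ (k t))) K :=
    ((hφ.comp_lowerSemicontinuous hN hφm).lowerSemicontinuousOn K).add
      hJ.neg.lowerSemicontinuousOn
  obtain ⟨ψ, hψ, hmin⟩ := hL.exists_isMinOn hne hKc
  have key : ∀ v : H, potential k A G v =
      ∫ t in (0:ℝ)..1, A t * G (StrongDual.toWeakDual (InnerProductSpace.toDual ℝ H v) (k t)) := by
    intro v
    unfold potential
    refine intervalIntegral.integral_congr fun t _ => ?_
    simp only [StrongDual.toWeakDual_apply, InnerProductSpace.toDual_apply_apply]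
    rw [real_inner_comm]
  have hψ' : StrongDual.toWeakDual (InnerProductSpace.toDual ℝ H
      ((InnerProductSpace.toDual ℝ H).symm (WeakDual.toStrongDual ψ))) = ψ := by simp
  refine ⟨(InnerProductSpace.toDual ℝ H).symm (WeakDual.toStrongDual ψ), ?_, fun w hw => ?_⟩
  · simpa using (hmem ψ).1 hψ
  · have := hmin (a := StrongDual.toWeakDual (InnerProductSpace.toDual ℝ H w))
      ((hmem _).2 (by simpa using hw))
    rw [key, key, hψ']
    simpa [sub_eq_add_neg] using this

theorem continuous_potential_integrand {k : ℝ → H} (hk : Continuous k)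
    {A G : ℝ → ℝ} (hA : Continuous A) (hG : Continuous G) (v : H) :
    Continuous fun t => A t * G (inner ℝ (k t) v) :=
  hA.mul (hG.comp (hk.inner continuous_const))

/-- The directional derivative of the integral functional. -/
theorem hasDerivAt_potential_line {k : ℝ → H} (hk : Continuous k)
    {A G g : ℝ → ℝ} (hA : Continuous A) (hg : Continuous g) (hG : ∀ x, HasDerivAt G (g x) x)
    (v w : H) :
    HasDerivAt (fun ε : ℝ => potential k A G (v + ε • w))
      (∫ t in (0:ℝ)..1, A t * g (inner ℝ (k t) v) * inner ℝ (k t) w) 0 := by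
  have hGc : Continuous G := continuous_iff_continuousAt.2 fun x => (hG x).continuousAt
  have hD : Continuous fun p : ℝ × ℝ =>
      A p.2 * g (inner ℝ (k p.2) (v + p.1 • w)) * inner ℝ (k p.2) w := by fun_prop
  obtain ⟨C, hC⟩ := ((isCompact_Icc (a := (-1:ℝ)) (b := 1)).prod
    (isCompact_Icc (a := (0:ℝ)) (b := 1))).exists_bound_of_continuousOn hD.continuousOn
  have := intervalIntegral.hasDerivAt_integral_of_dominated_loc_of_deriv_le (μ := volume)
    (a := (0:ℝ)) (b := 1) (x₀ := (0:ℝ)) (s := Icc (-1) 1) (bound := fun _ => C)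
    (F := fun ε t => A t * G (inner ℝ (k t) (v + ε • w)))
    (F' := fun ε t => A t * g (inner ℝ (k t) (v + ε • w)) * inner ℝ (k t) w)
    (Icc_mem_nhds (by norm_num) (by norm_num))
    (Filter.Eventually.of_forall fun ε =>
      (continuous_potential_integrand hk hA hGc _).aestronglyMeasurable)
    ((continuous_potential_integrand hk hA hGc _).intervalIntegrable _ _)
    ((hD.comp (Continuous.prodMk_right (0:ℝ))).aestronglyMeasurable)
    (Filter.Eventually.of_forall fun t ht ε hε => hC (ε, t) ⟨hε, by
      rw [uIoc_of_le zero_le_one] at ht; exact Ioc_subset_Icc_self ht⟩)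
    intervalIntegrable_const
    (Filter.Eventually.of_forall fun t _ ε _ => by
      have h1 : HasDerivAt (fun ε : ℝ => inner ℝ (k t) (v + ε • w)) (inner ℝ (k t) w) ε := by
        simp only [inner_add_right, inner_smul_right]
        simpa using ((hasDerivAt_id ε).mul_const (inner ℝ (k t) w)).const_add (inner ℝ (k t) v)
      have h2 := ((hG (inner ℝ (k t) (v + ε • w))).comp ε h1).const_mul (A t)
      rw [← mul_assoc] at h2
      exact h2)
  simpa [potential] using this.2

/-- The Euler–Lagrange equation at an interior minimizer on a ball. -/
theorem inner_eq_of_isMin {k : ℝ → H} (hk : Continuous k)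
    {A G g : ℝ → ℝ} (hA : Continuous A) (hg : Continuous g) (hG : ∀ x, HasDerivAt G (g x) x)
    {lam R : ℝ} {v : H} (hv : ‖v‖ < R)
    (hmin : ∀ w : H, ‖w‖ ≤ R →
      ‖v‖ ^ 2 / 2 - lam * potential k A G v ≤ ‖w‖ ^ 2 / 2 - lam * potential k A G w) (w : H) :
    inner ℝ v w = lam * ∫ t in (0:ℝ)..1, A t * g (inner ℝ (k t) v) * inner ℝ (k t) w := by
  have h1 := (hasDerivAt_potential_line hk hA hg hG v w).const_mul lam
  have h2 : HasDerivAt (fun ε : ℝ => ‖v + ε • w‖ ^ 2 / 2) (inner ℝ v w) 0 := by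
    have : HasDerivAt (fun ε : ℝ => v + ε • w) w 0 := by
      simpa using ((hasDerivAt_id (0:ℝ)).smul_const w).const_add v
    simpa using this.norm_sq.div_const 2
  have h3 : IsLocalMin (fun ε : ℝ => ‖v + ε • w‖ ^ 2 / 2 - lam * potential k A G (v + ε • w)) 0 := by
    have hc : Continuous fun ε : ℝ => ‖v + ε • w‖ := by fun_prop
    have : ∀ᶠ ε : ℝ in nhds 0, ‖v + ε • w‖ < R :=
      hc.continuousAt.eventually_lt continuousAt_const (by simpa using hv)
    filter_upwards [this] with ε hε
    simpa using hmin _ hε.le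
  have h4 := h3.hasDerivAt_eq_zero (h2.sub h1)
  linarith

end Hilbert

/-- A Hilbert-space feature map of the Green function of `-u''` with Dirichlet conditions. -/
theorem exists_green_feature_map :
    ∃ k : ℝ → Lp ℝ 2 (volume : Measure ℝ), Continuous k ∧ (∀ t, ‖k t‖ ≤ 1) ∧
      ∀ s ∈ Icc (0:ℝ) 1, ∀ t ∈ Icc (0:ℝ) 1, inner ℝ (k s) (k t) = min s t - s * t := by
  let e : ℝ → Lp ℝ 2 (volume : Measure ℝ) := fun t =>
    indicatorConstLp 2 (measurableSet_Ioc (a := (0:ℝ)) (b := t)) measure_Ioc_lt_top.ne 1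
  have he : ∀ s t, 0 ≤ s → 0 ≤ t → inner ℝ (e s) (e t) = min s t := by
    intro s t hs ht
    simp only [e]
    rw [L2.real_inner_indicatorConstLp_one_indicatorConstLp_one _ _ measure_Ioc_lt_top.ne
      measure_Ioc_lt_top.ne, Ioc_inter_Ioc]
    simp [hs, ht]
  let c : ℝ → ℝ := fun t => max 0 (min 1 t)
  have hc : Continuous c := by fun_prop
  have hc0 : ∀ t, 0 ≤ c t := fun t => le_max_left _ _
  have hc1 : ∀ t, c t ≤ 1 := fun t => max_le zero_le_one (min_le_left _ _)
  let k : ℝ → Lp ℝ 2 (volume : Measure ℝ) := fun t => e (c t) - c t • e 1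
  have hin : ∀ s t, inner ℝ (k s) (k t) = min (c s) (c t) - c s * c t := by
    intro s t
    simp only [k, inner_sub_left, inner_sub_right, inner_smul_left, inner_smul_right,
      he _ _ (hc0 s) (hc0 t), he _ _ (hc0 s) zero_le_one, he _ _ zero_le_one (hc0 t),
      he _ _ zero_le_one zero_le_one, min_eq_left (hc1 s), min_eq_right (hc1 t)]
    simp
  refine ⟨k, ?_, fun t => ?_, fun s hs t ht => ?_⟩
  · rw [continuous_iff_continuousAt]
    intro t
    rw [ContinuousAt, tendsto_iff_norm_sub_tendsto_zero]
    have h1 : ∀ s, ‖k s - k t‖ = √(c s - c s * c s - 2 * (min (c s) (c t) - c s * c t)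
        + (c t - c t * c t)) := by
      intro s
      rw [← Real.sqrt_sq (norm_nonneg (k s - k t)), norm_sub_sq_real, ← real_inner_self_eq_norm_sq,
        ← real_inner_self_eq_norm_sq, hin, hin, hin, min_self, min_self]
    simp only [h1]
    have h2 : Continuous fun s => √(c s - c s * c s - 2 * (min (c s) (c t) - c s * c t)
        + (c t - c t * c t)) := by fun_prop
    have h3 := h2.tendsto t
    rw [min_self] at h3
    convert h3 using 2
    ring_nf
    simp
  · have h := hin t t
    rw [real_inner_self_eq_norm_sq, min_self] at h
    have h0 := hc0 t
    have h1 := hc1 t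
    nlinarith [norm_nonneg (k t), sq_nonneg (c t)]
  · have h : ∀ x ∈ Icc (0:ℝ) 1, c x = x := fun x hx => by
      simp [c, min_eq_right hx.2, max_eq_right hx.1]
    rw [hin, h s hs, h t ht]

/-- The Green function solves `-w'' = h`, `w(0) = w(1) = 0`. -/
theorem integral_mul_green {h : ℝ → ℝ} (hh : Continuous h) {s : ℝ} (hs : s ∈ Icc (0:ℝ) 1) :
    ∫ t in (0:ℝ)..1, h t * (min s t - s * t) =
      s * (∫ x in (0:ℝ)..1, ∫ y in (0:ℝ)..x, h y) - ∫ x in (0:ℝ)..s, ∫ y in (0:ℝ)..x, h y := by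
  set P : ℝ → ℝ := fun x => ∫ y in (0:ℝ)..x, h y with hPdef
  have hP : ∀ x, HasDerivAt P (h x) x := fun x => (hh.integral_hasStrictDerivAt 0 x).hasDerivAt
  have hPc : Continuous P := continuous_iff_continuousAt.2 fun x => (hP x).continuousAt
  set Q : ℝ → ℝ := fun x => ∫ y in (0:ℝ)..x, P y with hQdef
  have hQ : ∀ x, HasDerivAt Q (P x) x := fun x => (hPc.integral_hasStrictDerivAt 0 x).hasDerivAt
  have hint : ∀ a b, IntervalIntegrable (fun t => h t * (min s t - s * t)) volume a b := fun a b =>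
    Continuous.intervalIntegrable (by fun_prop) _ _
  rw [← intervalIntegral.integral_add_adjacent_intervals (hint 0 s) (hint s 1)]
  have h1 : ∫ t in (0:ℝ)..s, h t * (min s t - s * t) = (1 - s) * (s * P s - Q s) := by
    have e1 : ∫ t in (0:ℝ)..s, h t * (min s t - s * t) = ∫ t in (0:ℝ)..s, (1 - s) * (t * h t) := by
      refine intervalIntegral.integral_congr fun t ht => ?_
      rw [uIcc_of_le hs.1] at ht
      simp only [min_eq_right ht.2]; ring
    have e2 : ∫ t in (0:ℝ)..s, t * h t = (s * P s - Q s) - (0 * P 0 - Q 0) :=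
      intervalIntegral.integral_eq_sub_of_hasDerivAt
        (f := fun t => t * P t - Q t) (fun t _ =>
          (((hasDerivAt_id t).mul (hP t)).sub (hQ t)).congr_deriv (by simp)) (Continuous.intervalIntegrable (by fun_prop) _ _)
    rw [e1, intervalIntegral.integral_const_mul, e2]
    simp [hQdef]
  have h2 : ∫ t in s..1, h t * (min s t - s * t) = s * (Q 1 - ((1 - s) * P s + Q s)) := by
    have e1 : ∫ t in s..1, h t * (min s t - s * t) = ∫ t in s..1, s * ((1 - t) * h t) := by
      refine intervalIntegral.integral_congr fun t ht => ?_
      rw [uIcc_of_le hs.2] at ht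
      simp only [min_eq_left ht.1]; ring
    have e2 : ∫ t in s..1, (1 - t) * h t = ((1 - 1) * P 1 + Q 1) - ((1 - s) * P s + Q s) :=
      intervalIntegral.integral_eq_sub_of_hasDerivAt
        (f := fun t => (1 - t) * P t + Q t) (fun t _ =>
          ((((hasDerivAt_id t).const_sub 1).mul (hP t)).add (hQ t)).congr_deriv (by simp)) (Continuous.intervalIntegrable (by fun_prop) _ _)
    rw [e1, intervalIntegral.integral_const_mul, e2]
    ring
  rw [h1, h2]
  ring

section Hilbert

variable {H : Type*} [NormedAddCommGroup H] [InnerProductSpace ℝ H]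

/-- A nonzero critical point of the energy functional yields a positive classical solution whose
Dirichlet energy is its squared norm. -/
theorem exists_solution_of_critical {k : ℝ → H} (hk : Continuous k)
    (hgram : ∀ s ∈ Icc (0:ℝ) 1, ∀ t ∈ Icc (0:ℝ) 1, inner ℝ (k s) (k t) = min s t - s * t)
    {A g : ℝ → ℝ} (hA : Continuous A) (hApos : ∀ t, 0 < A t) (hg : Continuous g)
    (hg0 : ∀ x, 0 ≤ g x) {lam : ℝ} (hlam : 0 < lam) {v : H} (hv : v ≠ 0)
    (hEL : ∀ w, inner ℝ v w =
      lam * ∫ t in (0:ℝ)..1, A t * g (inner ℝ (k t) v) * inner ℝ (k t) w) :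
    ∃ u d d2 : ℝ → ℝ, (∀ t, HasDerivAt u (d t) t) ∧ (∀ t, HasDerivAt d (d2 t) t) ∧
      Continuous d2 ∧ (∀ t ∈ Icc (0:ℝ) 1, -d2 t = lam * A t * g (u t)) ∧
      (∀ t ∈ Ioo (0:ℝ) 1, 0 < u t) ∧ u 0 = 0 ∧ u 1 = 0 ∧
      (∫ t in (0:ℝ)..1, |d t| ^ 2) = ‖v‖ ^ 2 := by
  set h : ℝ → ℝ := fun t => lam * A t * g (inner ℝ (k t) v) with hhdef
  have hh : Continuous h := by fun_prop
  have hh0 : ∀ t, 0 ≤ h t := fun t => mul_nonneg (mul_pos hlam (hApos t)).le (hg0 _)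
  have hEL' : ∀ w, inner ℝ v w = ∫ t in (0:ℝ)..1, h t * inner ℝ (k t) w := by
    intro w
    rw [hEL, ← intervalIntegral.integral_const_mul]
    exact intervalIntegral.integral_congr fun t _ => by simp only [hhdef]; ring
  set P : ℝ → ℝ := fun x => ∫ y in (0:ℝ)..x, h y with hPdef
  have hP : ∀ x, HasDerivAt P (h x) x := fun x => (hh.integral_hasStrictDerivAt 0 x).hasDerivAt
  have hPc : Continuous P := continuous_iff_continuousAt.2 fun x => (hP x).continuousAt
  set Q : ℝ → ℝ := fun x => ∫ y in (0:ℝ)..x, P y with hQdef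
  have hQ : ∀ x, HasDerivAt Q (P x) x := fun x => (hPc.integral_hasStrictDerivAt 0 x).hasDerivAt
  set u : ℝ → ℝ := fun s => s * Q 1 - Q s with hudef
  set d : ℝ → ℝ := fun s => Q 1 - P s with hddef
  have hu : ∀ t, HasDerivAt u (d t) t := fun t =>
    (((hasDerivAt_id t).mul_const (Q 1)).sub (hQ t)).congr_deriv (by simp [hddef])
  have hd : ∀ t, HasDerivAt d (-h t) t := fun t => (hP t).const_sub (Q 1)
  have huc : Continuous u := continuous_iff_continuousAt.2 fun x => (hu x).continuousAt
  have hdc : Continuous d := continuous_iff_continuousAt.2 fun x => (hd x).continuousAt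
  have hu0 : u 0 = 0 := by simp [hudef, hQdef]
  have hu1 : u 1 = 0 := by simp [hudef]
  have hugreen : ∀ s ∈ Icc (0:ℝ) 1, u s = ∫ t in (0:ℝ)..1, h t * (min s t - s * t) :=
    fun s hs => (integral_mul_green hh hs).symm
  have huv : ∀ s ∈ Icc (0:ℝ) 1, u s = inner ℝ (k s) v := by
    intro s hs
    rw [hugreen s hs, real_inner_comm, hEL']
    refine intervalIntegral.integral_congr fun t ht => ?_
    rw [uIcc_of_le zero_le_one] at ht
    simp only [hgram t ht s hs, min_comm t s, mul_comm t s]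
  have hvv : ‖v‖ ^ 2 = ∫ t in (0:ℝ)..1, h t * u t := by
    rw [← real_inner_self_eq_norm_sq, hEL']
    refine intervalIntegral.integral_congr fun t ht => ?_
    rw [uIcc_of_le zero_le_one] at ht
    simp only [huv t ht]
  refine ⟨u, d, fun t => -h t, hu, hd, hh.neg, fun t ht => ?_, fun s hs => ?_, hu0, hu1, ?_⟩
  · simp only [hhdef, neg_neg, huv t ht]
  · have hsI : s ∈ Icc (0:ℝ) 1 := Ioo_subset_Icc_self hs
    obtain ⟨t₀, ht₀, hpos⟩ : ∃ t₀ ∈ Icc (0:ℝ) 1, 0 < h t₀ * u t₀ := by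
      by_contra! hcon
      have : ∫ t in (0:ℝ)..1, h t * u t ≤ 0 := by
        have := intervalIntegral.integral_mono_on (μ := volume) zero_le_one
          ((hh.mul huc).intervalIntegrable (0:ℝ) 1)
          (intervalIntegrable_const (c := (0:ℝ))) hcon
        simpa using this
      have hvpos : 0 < ‖v‖ ^ 2 := by positivity
      linarith
    have hht₀ : 0 < h t₀ := lt_of_le_of_ne (hh0 t₀) fun e => by simp [← e] at hpos
    have h0 : t₀ ≠ 0 := by rintro rfl; simp [hu0] at hpos
    have h1 : t₀ ≠ 1 := by rintro rfl; simp [hu1] at hpos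
    have ht0 : 0 < t₀ := lt_of_le_of_ne ht₀.1 h0.symm
    have ht1 : t₀ < 1 := lt_of_le_of_ne ht₀.2 h1
    rw [hugreen s hsI]
    refine intervalIntegral.integral_pos zero_lt_one (by fun_prop) (fun t ht => ?_)
      ⟨t₀, ht₀, mul_pos hht₀ ?_⟩
    · refine mul_nonneg (hh0 t) ?_
      rcases le_total s t with hst | hst
      · rw [min_eq_left hst]; nlinarith [hs.1, ht.2]
      · rw [min_eq_right hst]; nlinarith [hs.2, ht.1]
    · rcases le_total s t₀ with hst | hst
      · rw [min_eq_left hst]; nlinarith [hs.1]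
      · rw [min_eq_right hst]; nlinarith [hs.2]
  · have key := intervalIntegral.integral_eq_sub_of_hasDerivAt (a := (0:ℝ)) (b := 1)
      (f := fun t => d t * u t) (fun t _ => (hd t).mul (hu t))
      (Continuous.intervalIntegrable (by fun_prop) _ _)
    simp only [hu0, hu1, mul_zero, sub_zero] at key
    rw [intervalIntegral.integral_add (Continuous.intervalIntegrable (by fun_prop) _ _)
      (Continuous.intervalIntegrable (by fun_prop) _ _)] at key
    rw [hvv]
    have e1 : ∫ t in (0:ℝ)..1, |d t| ^ 2 = ∫ t in (0:ℝ)..1, d t * d t :=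
      intervalIntegral.integral_congr fun t _ => by simp only [sq_abs]; ring
    have e2 : ∫ t in (0:ℝ)..1, -h t * u t = -∫ t in (0:ℝ)..1, h t * u t := by
      rw [← intervalIntegral.integral_neg]
      exact intervalIntegral.integral_congr fun t _ => by simp
    rw [e1]
    linarith

/-- If `G(x)/x²` is non-increasing and nowhere constant near `0`, then for an open interval of
parameters the energy functional has a nonzero minimizer inside the ball of radius `R`. -/
theorem exists_interval_interior_min [CompleteSpace H] {k : ℝ → H} (hk : Continuous k)
    (hk1 : ∀ t, ‖k t‖ ≤ 1)
    (hgram : ∀ s ∈ Icc (0:ℝ) 1, ∀ t ∈ Icc (0:ℝ) 1, inner ℝ (k s) (k t) = min s t - s * t)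
    {A G : ℝ → ℝ} (hA : Continuous A) (hApos : ∀ t, 0 < A t) (hG : Continuous G)
    {R : ℝ} (hR : 0 < R) (hGneg : ∀ x ≤ 0, G x = 0) (hGpos : ∀ x, 0 < x → x ≤ R → 0 < G x)
    (hscale : ∀ x s, 0 < x → x ≤ R → 0 < s → s ≤ 1 → s ^ 2 * G x ≤ G (s * x))
    (hstrict : ∀ x, 0 < x → x ≤ R → ∃ s, 0 < s ∧ s ≤ 1 ∧ s ^ 2 * G x < G (s * x)) :
    ∃ p q : ℝ, 0 ≤ p ∧ p < q ∧ ∀ lam ∈ Ioo p q, ∃ v : H, ‖v‖ < R ∧ v ≠ 0 ∧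
      ∀ w : H, ‖w‖ ≤ R →
        ‖v‖ ^ 2 / 2 - lam * potential k A G v ≤ ‖w‖ ^ 2 / 2 - lam * potential k A G w := by
  have hbound : ∀ (w : H) (t : ℝ), inner ℝ (k t) w ≤ ‖w‖ := fun w t =>
    (real_inner_le_norm _ _).trans (mul_le_of_le_one_left (norm_nonneg _) (hk1 t))
  have hGnonneg : ∀ x ≤ R, 0 ≤ G x := fun x hx => by
    rcases le_or_gt x 0 with h | h
    · exact (hGneg x h).ge
    · exact (hGpos x h hx).le
  have hcont : ∀ w : H, Continuous fun t => A t * G (inner ℝ (k t) w) :=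
    continuous_potential_integrand hk hA hG
  obtain ⟨v₁, hv₁, hmax⟩ := exists_min_sub_potential hk hA hG (φ := fun _ => 0)
    continuous_const monotone_const hR.le
  replace hmax : ∀ w : H, ‖w‖ ≤ R → potential k A G w ≤ potential k A G v₁ := fun w hw => by
    have := hmax w hw
    linarith
  have hhalf : (1 / 2 : ℝ) ∈ Icc (0:ℝ) 1 := by norm_num
  have hJ₁ : 0 < potential k A G v₁ := by
    have hw : ‖R • k (1 / 2)‖ ≤ R := by
      rw [norm_smul, Real.norm_of_nonneg hR.le]
      exact mul_le_of_le_one_right hR.le (hk1 _)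
    refine lt_of_lt_of_le ?_ (hmax _ hw)
    refine intervalIntegral.integral_pos zero_lt_one (hcont _).continuousOn
      (fun t _ => mul_nonneg (hApos t).le (hGnonneg _ ((hbound _ t).trans hw)))
      ⟨1 / 2, hhalf, mul_pos (hApos _) (hGpos _ ?_ ((hbound _ _).trans hw))⟩
    rw [inner_smul_right, hgram _ hhalf _ hhalf, min_self]
    exact mul_pos hR (by norm_num)
  obtain ⟨v₂, hv₂, hJ₂⟩ : ∃ w : H, ‖w‖ ≤ R ∧
      ‖w‖ ^ 2 * potential k A G v₁ < R ^ 2 * potential k A G w := by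
    by_contra! hcon
    obtain ⟨t₀, ht₀, hpos⟩ : ∃ t₀ ∈ Icc (0:ℝ) 1, 0 < inner ℝ (k t₀) v₁ := by
      by_contra! hle
      have : potential k A G v₁ = ∫ t in (0:ℝ)..1, (0:ℝ) := by
        refine intervalIntegral.integral_congr fun t ht => ?_
        rw [uIcc_of_le zero_le_one] at ht
        simp [hGneg _ (hle t ht)]
      rw [this] at hJ₁
      simp at hJ₁
    obtain ⟨s, hs0, hs1, hs⟩ := hstrict _ hpos ((hbound _ _).trans hv₁)
    have hlt : s ^ 2 * potential k A G v₁ < potential k A G (s • v₁) := by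
      unfold potential
      rw [← intervalIntegral.integral_const_mul]
      refine intervalIntegral.integral_lt_integral_of_continuousOn_of_le_of_exists_lt zero_lt_one
        ((hcont v₁).const_mul (s ^ 2)).continuousOn (hcont _).continuousOn (fun t _ => ?_)
        ⟨t₀, ht₀, ?_⟩
      · rw [inner_smul_right, mul_left_comm]
        refine mul_le_mul_of_nonneg_left ?_ (hApos t).le
        rcases le_or_gt (inner ℝ (k t) v₁) 0 with h | h
        · rw [hGneg _ h, hGneg _ (mul_nonpos_of_nonneg_of_nonpos hs0.le h), mul_zero]
        · exact hscale _ _ h ((hbound _ _).trans hv₁) hs0 hs1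
      · rw [inner_smul_right, mul_left_comm]
        exact mul_lt_mul_of_pos_left hs (hApos t₀)
    have hn : ‖s • v₁‖ = s * ‖v₁‖ := by rw [norm_smul, Real.norm_of_nonneg hs0.le]
    have h1 := hcon (s • v₁) (by rw [hn]; nlinarith [norm_nonneg v₁])
    rw [hn, mul_pow] at h1
    have h2 : ‖v₁‖ ^ 2 ≤ R ^ 2 := pow_le_pow_left₀ (norm_nonneg _) hv₁ 2
    have h3 : s ^ 2 * ‖v₁‖ ^ 2 * potential k A G v₁ ≤ s ^ 2 * R ^ 2 * potential k A G v₁ := by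
      gcongr
    nlinarith [mul_lt_mul_of_pos_left hlt (pow_pos hR 2)]
  have hJ₂pos : 0 < potential k A G v₂ := by
    have : 0 ≤ ‖v₂‖ ^ 2 * potential k A G v₁ := by positivity
    exact pos_of_mul_pos_right (this.trans_lt hJ₂) (by positivity)
  refine ⟨‖v₂‖ ^ 2 / (2 * potential k A G v₂), R ^ 2 / (2 * potential k A G v₁), by positivity,
    ?_, fun lam hlam => ?_⟩
  · rw [div_lt_div_iff₀ (by positivity) (by positivity)]
    linarith
  have hlam0 : 0 < lam := lt_of_le_of_lt (by positivity) hlam.1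
  have hlow : ‖v₂‖ ^ 2 / 2 - lam * potential k A G v₂ < 0 := by
    have := (div_lt_iff₀ (by positivity)).1 hlam.1
    linarith
  have hhigh : 0 < R ^ 2 / 2 - lam * potential k A G v₁ := by
    have := (lt_div_iff₀ (by positivity)).1 hlam.2
    linarith
  obtain ⟨v, hv, hmin⟩ := exists_min_sub_potential hk (hA.const_mul lam) hG
    (φ := fun x => max x 0 ^ 2 / 2) (by fun_prop)
    (fun x y hxy => by
      have := pow_le_pow_left₀ (le_max_right x 0) (max_le_max_right 0 hxy) 2
      simp only
      linarith) hR.le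
  have hmul : ∀ w : H, potential k (fun t => lam * A t) G w = lam * potential k A G w := by
    intro w
    unfold potential
    simp only [mul_assoc]
    rw [intervalIntegral.integral_const_mul]
  simp only [hmul, max_eq_left (norm_nonneg _)] at hmin
  have hvneg := (hmin v₂ hv₂).trans_lt hlow
  refine ⟨v, lt_of_le_of_ne hv fun e => ?_, ?_, hmin⟩
  · rw [e] at hvneg
    have := mul_le_mul_of_nonneg_left (hmax v hv) hlam0.le
    linarith
  · rintro rfl
    simp [potential, hGneg 0 le_rfl] at hvneg

end Hilbert

theorem stmt1
    (f α : ℝ → ℝ)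
    (hf_cont : ContinuousOn f (Ici 0))
    (hf_nonneg : ∀ ξ ∈ Ici (0:ℝ), 0 ≤ f ξ)
    (hf0 : f 0 = 0)
    (hα_cont : ContinuousOn α (Icc 0 1))
    (hα_pos : ∀ t ∈ Icc (0:ℝ) 1, 0 < α t)
    (F : ℝ → ℝ) (hF : ∀ ξ, F ξ = ∫ t in (0:ℝ)..ξ, f t)
    (a : ℝ) (ha : 0 < a)
    (hmono : ∀ ξ₁ ξ₂, 0 < ξ₁ → ξ₁ ≤ ξ₂ → ξ₂ ≤ a → F ξ₂ / ξ₂ ^ 2 ≤ F ξ₁ / ξ₁ ^ 2)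
    (hnotconst : ∀ b > (0:ℝ), ¬ ∃ c : ℝ, ∀ ξ ∈ Ioc (0:ℝ) b, F ξ / ξ ^ 2 = c) :
    ∀ r > (0:ℝ), ∃ p q : ℝ, 0 ≤ p ∧ p < q ∧ ∀ lam ∈ Ioo p q,
      ∃ u d d2 : ℝ → ℝ,
        (∀ t ∈ Icc (0:ℝ) 1, HasDerivWithinAt u (d t) (Icc 0 1) t) ∧
        (∀ t ∈ Icc (0:ℝ) 1, HasDerivWithinAt d (d2 t) (Icc 0 1) t) ∧
        ContinuousOn d2 (Icc 0 1) ∧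
        (∀ t ∈ Icc (0:ℝ) 1, -d2 t = lam * α t * f (u t)) ∧
        (∀ t ∈ Ioo (0:ℝ) 1, 0 < u t) ∧
        u 0 = 0 ∧ u 1 = 0 ∧
        (∫ t in (0:ℝ)..1, |d t| ^ 2) < r := by
  intro r hr
  set g : ℝ → ℝ := fun x => f (max x 0) with hgdef
  have hg : Continuous g :=
    hf_cont.comp_continuous (by fun_prop) fun x => le_max_right x 0
  have hg0 : ∀ x, 0 ≤ g x := fun x => hf_nonneg _ (le_max_right x 0)
  have hgneg : ∀ x ≤ 0, g x = 0 := fun x hx => by simp [hgdef, max_eq_right hx, hf0]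
  set G : ℝ → ℝ := fun x => ∫ t in (0:ℝ)..x, g t with hGdef
  have hG : ∀ x, HasDerivAt G (g x) x := fun x => (hg.integral_hasStrictDerivAt 0 x).hasDerivAt
  have hGc : Continuous G := continuous_iff_continuousAt.2 fun x => (hG x).continuousAt
  have hGmono : Monotone G :=
    monotone_of_deriv_nonneg (fun x => (hG x).differentiableAt) fun x => by
      rw [(hG x).deriv]; exact hg0 x
  have hGneg : ∀ x ≤ 0, G x = 0 := by
    intro x hx
    have : G x = ∫ t in (0:ℝ)..x, (0:ℝ) := by
      refine intervalIntegral.integral_congr fun t ht => ?_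
      rw [uIcc_of_ge hx] at ht
      exact hgneg t ht.2
    simpa using this
  have hGF : ∀ x, 0 ≤ x → F x = G x := by
    intro x hx
    rw [hF]
    refine intervalIntegral.integral_congr fun t ht => ?_
    rw [uIcc_of_le hx] at ht
    simp only [hgdef, max_eq_left ht.1]
  have hcross : ∀ x s, 0 < x → 0 < s →
      (F (s * x) / (s * x) ^ 2 - F x / x ^ 2) * (s * x) ^ 2 = G (s * x) - s ^ 2 * G x := by
    intro x s hx hs
    rw [hGF x hx.le, hGF _ (mul_pos hs hx).le]
    field_simp
  have hscale : ∀ x s, 0 < x → x ≤ a → 0 < s → s ≤ 1 → s ^ 2 * G x ≤ G (s * x) := by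
    intro x s hx hxa hs hs1
    have h1 := hmono (s * x) x (mul_pos hs hx) (mul_le_of_le_one_left hx.le hs1) hxa
    have h2 := mul_nonneg (sub_nonneg.2 h1) (sq_nonneg (s * x))
    rw [hcross x s hx hs] at h2
    linarith
  have hstrict : ∀ x, 0 < x → x ≤ a → ∃ s, 0 < s ∧ s ≤ 1 ∧ s ^ 2 * G x < G (s * x) := by
    intro x hx hxa
    by_contra! hcon
    refine hnotconst x hx ⟨F x / x ^ 2, fun ξ hξ => ?_⟩
    refine le_antisymm ?_ (hmono ξ x hξ.1 hξ.2 hxa)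
    have hs : 0 < ξ / x := div_pos hξ.1 hx
    have h1 := hcon (ξ / x) hs ((div_le_one hx).2 hξ.2)
    have h2 := hcross x (ξ / x) hx hs
    rw [div_mul_cancel₀ _ hx.ne'] at h1 h2
    have h3 := nonpos_of_mul_nonpos_left (h2.le.trans (sub_nonpos.2 h1)) (pow_pos hξ.1 2)
    linarith
  have hGpos : ∀ x, 0 < x → x ≤ a → 0 < G x := by
    intro x hx hxa
    obtain ⟨s, hs0, hs1, hs⟩ := hstrict x hx hxa
    have h1 : 0 ≤ G x := by rw [← hGneg 0 le_rfl]; exact hGmono hx.le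
    exact ((mul_nonneg (sq_nonneg s) h1).trans_lt hs).trans_le
      (hGmono (mul_le_of_le_one_left hx.le hs1))
  set A : ℝ → ℝ := fun t => α (max 0 (min 1 t)) with hAdef
  have hclamp : ∀ t : ℝ, max 0 (min 1 t) ∈ Icc (0:ℝ) 1 := fun t =>
    ⟨le_max_left _ _, max_le zero_le_one (min_le_left _ _)⟩
  have hA : Continuous A := hα_cont.comp_continuous (by fun_prop) hclamp
  have hApos : ∀ t, 0 < A t := fun t => hα_pos _ (hclamp t)
  have hAα : ∀ t ∈ Icc (0:ℝ) 1, A t = α t := fun t ht => by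
    simp [hAdef, min_eq_right ht.2, max_eq_right ht.1]
  obtain ⟨k, hk, hk1, hgram⟩ := exists_green_feature_map
  have hRa : min a √r ≤ a := min_le_left _ _
  obtain ⟨p, q, hp, hpq, hmain⟩ := exists_interval_interior_min hk hk1 hgram hA hApos hGc
    (R := min a √r) (lt_min ha (Real.sqrt_pos.2 hr)) hGneg
    (fun x hx hxR => hGpos x hx (hxR.trans hRa))
    (fun x s hx hxR => hscale x s hx (hxR.trans hRa))
    (fun x hx hxR => hstrict x hx (hxR.trans hRa))
  refine ⟨p, q, hp, hpq, fun lam hlam => ?_⟩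
  obtain ⟨v, hvR, hv0, hmin⟩ := hmain lam hlam
  obtain ⟨u, d, d2, hu, hd, hd2, heq, hpos, hu0, hu1, hen⟩ :=
    exists_solution_of_critical hk hgram hA hApos hg hg0 (hp.trans_lt hlam.1) hv0
      (inner_eq_of_isMin hk hA hg hG hvR hmin)
  refine ⟨u, d, d2, fun t _ => (hu t).hasDerivWithinAt, fun t _ => (hd t).hasDerivWithinAt,
    hd2.continuousOn, fun t ht => ?_, hpos, hu0, hu1, ?_⟩
  · have hut : 0 ≤ u t := by
      rcases eq_or_lt_of_le ht.1 with h | h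
      · rw [← h, hu0]
      rcases eq_or_lt_of_le ht.2 with h' | h'
      · rw [h', hu1]
      exact (hpos t ⟨h, h'⟩).le
    rw [heq t ht, hAα t ht, hgdef]
    simp only [max_eq_left hut]
  · rw [hen, ← Real.sq_sqrt hr.le]
    exact pow_lt_pow_left₀ (hvR.trans_le (min_le_right _ _)) (norm_nonneg _) two_ne_zero
end
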